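/- arXiv:2605.26606 — 3 statements merged into one kernel-verified Lean document; each statement's English description precedes it below -/
import Mathlib

section
/- Suppose g_i = g⁺ for every i ∈ S₊ and g_i = g⁻ for every i ∉ S₊, where g⁺, g⁻ are vectors in a real normed vector space V. Then the norm of the group policy-gradient vector satisfies ‖(1/G) · Σ_{i=1}^G Â_i g_i‖ = (|S₊ᴬ| / G) · ‖g⁺ − g⁻‖. -/
/-- A combination with weights summing to zero of vectors taking the value `a` where `p` holds and
`b` elsewhere is the total weight on `p` times `a - b`. -/
theorem sum_smul_eq_sum_filter_smul_sub {ι R M : Type*} [Ring R] [AddCommGroup M] [Module R M]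
    (s : Finset ι) (p : ι → Prop) [DecidablePred p] (w : ι → R) (g : ι → M) (a b : M)
    (hw : ∑ i ∈ s, w i = 0) (ha : ∀ i, p i → g i = a) (hb : ∀ i, ¬ p i → g i = b) :
    ∑ i ∈ s, w i • g i = (∑ i ∈ s.filter p, w i) • (a - b) := by
  have hsub : ∑ i ∈ s, w i • (g i - b) = ∑ i ∈ s, w i • g i := by
    simp only [smul_sub, Finset.sum_sub_distrib, ← Finset.sum_smul, hw, zero_smul, sub_zero]
  rw [← hsub, Finset.sum_smul, Finset.sum_filter]
  refine Finset.sum_congr rfl fun i _ => ?_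
  split_ifs with hi
  · rw [ha i hi]
  · rw [hb i hi, sub_self, smul_zero]

/-- Two-cluster norm identity: under the two-cluster assumption the norm of the
group policy-gradient vector equals `(|S₊ᴬ| / G) * ‖g⁺ − g⁻‖`. -/
theorem two_cluster_gradient_norm
    {V : Type*} [NormedAddCommGroup V] [NormedSpace ℝ V]
    (G : ℕ) (hG : 1 ≤ G) (r : Fin G → ℝ) (μ σ : ℝ)
    (hμ : μ = (1 / (G : ℝ)) * ∑ i, r i)
    (hσ : σ = Real.sqrt ((1 / (G : ℝ)) * ∑ i, (r i - μ) ^ 2))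
    (hσpos : 0 < σ)
    (g : Fin G → V) (gp gm : V)
    (hgp : ∀ i, μ ≤ r i → g i = gp)
    (hgm : ∀ i, ¬ μ ≤ r i → g i = gm) :
    ‖((G : ℝ)⁻¹) • ∑ i, ((r i - μ) / σ) • g i‖
      = (|∑ i ∈ Finset.univ.filter (fun i => μ ≤ r i), (r i - μ) / σ| / (G : ℝ))
        * ‖gp - gm‖ := by
  have hG0 : (G : ℝ) ≠ 0 := Nat.cast_ne_zero.mpr (by lia)
  have hsum : ∑ i, (r i - μ) / σ = 0 := by
    rw [← Finset.sum_div, Finset.sum_sub_distrib, Finset.sum_const, Finset.card_univ,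
      Fintype.card_fin, nsmul_eq_mul, hμ, ← mul_assoc, mul_one_div_cancel hG0, one_mul, sub_self,
      zero_div]
  rw [sum_smul_eq_sum_filter_smul_sub _ (fun i => μ ≤ r i) _ g gp gm hsum hgp hgm, norm_smul,
    norm_smul, norm_inv, Real.norm_natCast, Real.norm_eq_abs, div_eq_inv_mul, mul_assoc]
end

section
/- Tightness of the positive advantage mass bound (converse direction): if S₊ᴬ = G / 2, then G is even and there exists a real number a > 0 such that every d_i lies in {a, −a}, with exactly G/2 indices satisfying d_i = a and exactly G/2 satisfying d_i = −a. -/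
/-- For a finite family of reals, the sum of absolute values is twice the sum of the nonnegative
terms minus the sum of all terms. -/
theorem sum_abs_eq_two_mul_sum_nonneg_sub_sum {ι : Type*} [Fintype ι] (d : ι → ℝ) :
    ∑ i, |d i| = 2 * ∑ i ∈ Finset.univ.filter (fun i => 0 ≤ d i), d i - ∑ i, d i := by
  rw [Finset.sum_filter, Finset.mul_sum, ← Finset.sum_sub_distrib]
  refine Finset.sum_congr rfl fun i _ => ?_
  split_ifs with h
  · rw [abs_of_nonneg h]; ring
  · rw [abs_of_neg (not_le.mp h)]; ring

/-- Equality case of Cauchy–Schwarz against the constant family: if the absolute values have mean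
`s` and the squares have mean `s ^ 2`, then every absolute value equals `s`. -/
theorem abs_eq_of_sum_abs_eq_of_sum_sq_eq {ι : Type*} [Fintype ι] {d : ι → ℝ} {s : ℝ}
    (habs : ∑ i, |d i| = Fintype.card ι * s) (hsq : ∑ i, d i ^ 2 = Fintype.card ι * s ^ 2)
    (i : ι) : |d i| = s := by
  have hzero : ∑ i, (|d i| - s) ^ 2 = 0 := by
    have hexpand : ∀ i, (|d i| - s) ^ 2 = d i ^ 2 - 2 * s * |d i| + s ^ 2 := fun i => by
      rw [← sq_abs (d i)]; ring
    simp only [hexpand, Finset.sum_add_distrib, Finset.sum_sub_distrib, ← Finset.mul_sum, habs,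
      hsq, Finset.sum_const, Finset.card_univ, nsmul_eq_mul]
    ring
  have hi := (Finset.sum_eq_zero_iff_of_nonneg fun i _ => sq_nonneg (|d i| - s)).mp hzero i
    (Finset.mem_univ i)
  exact sub_eq_zero.mp (pow_eq_zero_iff two_ne_zero |>.mp hi)


/-- Tightness of the positive advantage mass bound (converse direction):
if `S₊ᴬ = G / 2` then `G` is even and there is `a > 0` with every deviation
in `{a, −a}`, exactly `G/2` equal to `a` and exactly `G/2` equal to `−a`. -/
theorem positive_advantage_mass_bound_tight_converse
    (G : ℕ) (hG : 1 ≤ G) (r : Fin G → ℝ) (μ σ : ℝ)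
    (hμ : μ = (1 / (G : ℝ)) * ∑ i, r i)
    (hσ : σ = Real.sqrt ((1 / (G : ℝ)) * ∑ i, (r i - μ) ^ 2))
    (hσpos : 0 < σ)
    (heq : (∑ i ∈ Finset.univ.filter (fun i => μ ≤ r i), (r i - μ) / σ) = (G : ℝ) / 2) :
    Even G ∧ ∃ a : ℝ, 0 < a ∧ (∀ i, r i - μ = a ∨ r i - μ = -a) ∧
      (Finset.univ.filter (fun i => r i - μ = a)).card = G / 2 ∧
      (Finset.univ.filter (fun i => r i - μ = -a)).card = G / 2 := by
  have hG0 : (G : ℝ) ≠ 0 := by positivity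
  have hsum : ∑ i, (r i - μ) = 0 := by
    rw [Finset.sum_sub_distrib, Finset.sum_const, Finset.card_univ, Fintype.card_fin,
      nsmul_eq_mul, hμ]
    field_simp
    ring
  have hsq : ∑ i, (r i - μ) ^ 2 = G * σ ^ 2 := by
    rw [hσ, Real.sq_sqrt (by positivity)]
    field_simp
  have hpos : ∑ i ∈ Finset.univ.filter (fun i => μ ≤ r i), (r i - μ) = G / 2 * σ := by
    rwa [← Finset.sum_div, div_eq_iff hσpos.ne'] at heq
  have habs : ∑ i, |r i - μ| = G * σ := by
    rw [sum_abs_eq_two_mul_sum_nonneg_sub_sum, hsum]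
    simp only [sub_nonneg, hpos]
    ring
  have hval : ∀ i, r i - μ = σ ∨ r i - μ = -σ := fun i =>
    (abs_eq hσpos.le).mp <| abs_eq_of_sum_abs_eq_of_sum_sq_eq (d := fun i => r i - μ)
      (by simpa using habs) (by simpa using hsq) i
  have hfilter : Finset.univ.filter (fun i => μ ≤ r i) =
      Finset.univ.filter (fun i => r i - μ = σ) := by
    refine Finset.filter_congr fun i _ => ⟨fun h => ?_, fun h => by linarith⟩
    rcases hval i with h' | h'
    · exact h'
    · linarith
  have hfilter_neg : Finset.univ.filter (fun i => r i - μ = -σ) =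
      Finset.univ.filter (fun i => ¬ r i - μ = σ) := by
    refine Finset.filter_congr fun i _ => ⟨fun h h' => by linarith, (hval i).resolve_left⟩
  have hcard : 2 * (Finset.univ.filter (fun i => r i - μ = σ)).card = G := by
    rw [hfilter, Finset.sum_congr rfl fun i hi => (Finset.mem_filter.mp hi).2, Finset.sum_const,
      nsmul_eq_mul] at hpos
    have hcast := mul_right_cancel₀ hσpos.ne' hpos
    have : (2 : ℝ) * (Finset.univ.filter (fun i => r i - μ = σ)).card = G := by linarith
    exact_mod_cast this
  have hcompl := Finset.card_filter_add_card_filter_not (s := Finset.univ)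
    (fun i => r i - μ = σ)
  rw [Finset.card_univ, Fintype.card_fin] at hcompl
  refine ⟨⟨_, by rw [← two_mul]; exact hcard.symm⟩, σ, hσpos, hval, by omega, ?_⟩
  rw [hfilter_neg]
  omega
end

section
/- Suppose g_i = g⁺ for every i ∈ S₊ and g_i = g⁻ for every i ∉ S₊, where g⁺, g⁻ are vectors in a real normed vector space V. Then the norm of the group policy-gradient vector is bounded by ‖(1/G) · Σ_{i=1}^G Â_i g_i‖ ≤ (1/2) · ‖g⁺ − g⁻‖. -/
/-- A sum of absolute values is at most the number of terms when the squares sum to at most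
that number. -/
theorem sum_abs_le_card_of_sum_sq_le_card {ι : Type*} [Fintype ι] (a : ι → ℝ)
    (ha : ∑ i, a i ^ 2 ≤ Fintype.card ι) : ∑ i, |a i| ≤ Fintype.card ι := by
  have h : ∑ i, |a i| ≤ ∑ i, (a i ^ 2 + 1) / 2 :=
    Finset.sum_le_sum fun i _ => by nlinarith [sq_nonneg (|a i| - 1), sq_abs (a i)]
  rw [← Finset.sum_div, Finset.sum_add_distrib] at h
  simp only [Finset.sum_const, Finset.card_univ, nsmul_eq_mul, mul_one] at h
  linarith

/-- If the weights sum to zero and the vectors take one value on nonnegative weights and another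
on negative weights, the weighted sum is a multiple of half the difference of the two values. -/
theorem sum_smul_eq_sum_abs_smul_half_sub {ι V : Type*} [Fintype ι] [AddCommGroup V] [Module ℝ V]
    (a : ι → ℝ) (g : ι → V) (gp gm : V) (ha : ∑ i, a i = 0)
    (hgp : ∀ i, 0 ≤ a i → g i = gp) (hgm : ∀ i, a i < 0 → g i = gm) :
    ∑ i, a i • g i = (∑ i, |a i|) • ((1 / 2 : ℝ) • (gp - gm)) := by
  have h : ∀ i, a i • g i =
      a i • ((1 / 2 : ℝ) • (gp + gm)) + |a i| • ((1 / 2 : ℝ) • (gp - gm)) := by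
    intro i
    rcases le_or_gt 0 (a i) with hi | hi
    · rw [hgp i hi, abs_of_nonneg hi]
      module
    · rw [hgm i hi, abs_of_neg hi]
      module
  rw [Finset.sum_congr rfl fun i _ => h i, Finset.sum_add_distrib, ← Finset.sum_smul,
    ← Finset.sum_smul, ha, zero_smul, zero_add]

/-- Under the two-cluster assumption, the group gradient magnitude is at most
half the inter-cluster gradient gap. -/
theorem two_cluster_gradient_norm_le
    {V : Type*} [NormedAddCommGroup V] [NormedSpace ℝ V]
    (G : ℕ) (hG : 1 ≤ G) (r : Fin G → ℝ) (μ σ : ℝ)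
    (hμ : μ = (1 / (G : ℝ)) * ∑ i, r i)
    (hσ : σ = Real.sqrt ((1 / (G : ℝ)) * ∑ i, (r i - μ) ^ 2))
    (hσpos : 0 < σ)
    (g : Fin G → V) (gp gm : V)
    (hgp : ∀ i, μ ≤ r i → g i = gp)
    (hgm : ∀ i, ¬ μ ≤ r i → g i = gm) :
    ‖((G : ℝ)⁻¹) • ∑ i, ((r i - μ) / σ) • g i‖ ≤ (1 / 2) * ‖gp - gm‖ := by
  have hG0 : (0 : ℝ) < G := by exact_mod_cast hG
  have hsum : ∑ i, (r i - μ) / σ = 0 := by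
    rw [← Finset.sum_div, Finset.sum_sub_distrib]
    simp only [Finset.sum_const, Finset.card_univ, Fintype.card_fin, nsmul_eq_mul]
    rw [hμ]
    field_simp
    simp
  have hsq : ∑ i, ((r i - μ) / σ) ^ 2 = G := by
    have hσ2 : σ ^ 2 = (1 / (G : ℝ)) * ∑ i, (r i - μ) ^ 2 := by
      rw [hσ, Real.sq_sqrt (by positivity)]
    simp_rw [div_pow]
    rw [← Finset.sum_div, div_eq_iff (by positivity), hσ2]
    field_simp
  have habs : ∑ i, |(r i - μ) / σ| ≤ G := by
    simpa using sum_abs_le_card_of_sum_sq_le_card (fun i => (r i - μ) / σ) (by simp [hsq])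
  have hp : ∀ i, 0 ≤ (r i - μ) / σ → g i = gp := fun i hi =>
    hgp i (sub_nonneg.1 (by simpa [hσpos.ne'] using mul_nonneg hi hσpos.le))
  have hm : ∀ i, (r i - μ) / σ < 0 → g i = gm := fun i hi =>
    hgm i fun h => hi.not_ge (div_nonneg (sub_nonneg.2 h) hσpos.le)
  rw [sum_smul_eq_sum_abs_smul_half_sub _ g gp gm hsum hp hm, smul_smul, norm_smul, norm_smul,
    Real.norm_of_nonneg (by positivity), Real.norm_of_nonneg (by norm_num)]
  refine mul_le_of_le_one_left (by positivity) ?_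
  rwa [inv_mul_le_iff₀ hG0, mul_one]
end
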